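/- arXiv:math/0502148 — 2 statements merged into one kernel-verified Lean document; each statement's English description precedes it below -/
import Mathlib

section
/- The topological fundamental group π₁(HE,p) of the Hawaiian earring, endowed with the quotient topology, admits no complete metric compatible with its topology; that is, π₁(HE,p) is not completely metrizable. -/
noncomputable section

/-- The loop space `C_q(Z)` : the space of continuous loops at `q`, i.e. continuous maps
`[0,1] → Z` sending `0` and `1` to `q`, topologized as a subspace of `C([0,1], Z)` with
the compact-open topology. -/
abbrev LoopSp (Z : Type*) [TopologicalSpace Z] (q : Z) : Type _ :=
  {f : C(unitInterval, Z) // f 0 = q ∧ f 1 = q}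

/-- The topological fundamental group `π₁(Z,q)` : the quotient of the loop space `C_q(Z)`
obtained by identifying loops lying in the same path component of `C_q(Z)`, endowed with
the quotient topology. -/
abbrev TopPi1 (Z : Type*) [TopologicalSpace Z] (q : Z) : Type _ :=
  Quotient (pathSetoid (LoopSp Z q))

/-- The circle `Cₙ ⊆ ℝ²` of radius `1/n` centered at `(1/n, 0)` (intended for `n ≥ 1`). -/
def circ (n : ℕ) : Set (ℝ × ℝ) :=
  {q | (q.1 - 1 / n) ^ 2 + q.2 ^ 2 = (1 / n) ^ 2}

/-- The Hawaiian earring `HE = ⋃_{n ≥ 1} Cₙ`. -/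
def HE : Set (ℝ × ℝ) := ⋃ n, ⋃ (_ : 1 ≤ n), circ n

lemma origin_mem_HE : ((0 : ℝ), (0 : ℝ)) ∈ HE := by
  refine Set.mem_iUnion.2 ⟨1, Set.mem_iUnion.2 ⟨le_refl 1, ?_⟩⟩
  simp [circ]

/-- The basepoint `p = (0,0)` of the Hawaiian earring. -/
def hep : HE := ⟨((0 : ℝ), (0 : ℝ)), origin_mem_HE⟩

open Topology Filter

/-- The standard parametrization of the unit circle by `ℝ / ℤ`. -/
def ee (s : ℝ) : ℂ := (Circle.exp (2 * Real.pi * s) : ℂ)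

lemma ee_continuous : Continuous ee := by
  unfold ee; fun_prop

lemma ee_zero : ee 0 = 1 := by simp [ee]

lemma ee_norm (s : ℝ) : ‖ee s‖ = 1 := Circle.norm_coe _

lemma ee_add (s t : ℝ) : ee (s + t) = ee s * ee t := by
  simp [ee, mul_add]

lemma ee_eq (s : ℝ) : ee s = Complex.exp ((2 * Real.pi * s : ℝ) * Complex.I) := by
  simp [ee]

lemma ee_eq_one {s : ℝ} (h : ee s = 1) : ∃ n : ℤ, s = n := by
  rw [ee_eq, Complex.exp_eq_one_iff] at h
  obtain ⟨n, hn⟩ := h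
  refine ⟨n, ?_⟩
  have h1 : ((2 * Real.pi * s : ℝ) : ℂ) = ((n * (2 * Real.pi) : ℝ) : ℂ) := by
    apply mul_right_cancel₀ Complex.I_ne_zero
    rw [hn]; push_cast; ring
  have h2 := Complex.ofReal_injective h1
  have := Real.pi_pos
  field_simp at h2
  linarith

lemma ee_int (n : ℤ) : ee n = 1 := by
  rw [ee_eq, Complex.exp_eq_one_iff]
  exact ⟨n, by push_cast; ring⟩

/-- `θ` is the lift of `u` starting at `0`. -/
def IsLft (u : C(unitInterval, ℂ)) (θ : C(unitInterval, ℝ)) : Prop :=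
  θ 0 = 0 ∧ ∀ t, ee (θ t) = u t

lemma IsLft.unique {u : C(unitInterval, ℂ)} {θ θ' : C(unitInterval, ℝ)}
    (h : IsLft u θ) (h' : IsLft u θ') : θ = θ' := by
  have key : (fun t => 2 * Real.pi * θ t) = (fun t => 2 * Real.pi * θ' t) := by
    refine Circle.isCoveringMap_exp.eq_of_comp_eq (by fun_prop) (by fun_prop) ?_ 0 ?_
    · funext t
      apply Circle.coe_injective
      exact (h.2 t).trans (h'.2 t).symm
    · simp [h.1, h'.1]
  ext t
  have := congrFun key t
  have := Real.pi_pos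
  simp_all

lemma exists_lft {u : C(unitInterval, ℂ)} (h0 : u 0 = 1) (h1 : ∀ t, ‖u t‖ = 1) :
    ∃ θ, IsLft u θ := by
  let v : C(unitInterval, Circle) :=
    ⟨fun t => ⟨u t, by simp [Submonoid.unitSphere, h1 t]⟩, by
      exact Continuous.subtype_mk u.continuous _⟩
  obtain ⟨Γ, hΓ, hΓ0⟩ := Circle.isCoveringMap_exp.exists_path_lifts v 0 (by
    apply Circle.coe_injective
    rw [Circle.exp_zero]
    exact h0)
  refine ⟨⟨fun t => Γ t / (2 * Real.pi), by fun_prop⟩, ?_, ?_⟩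
  · simp [hΓ0]
  · intro t
    have := congrArg (fun z : Circle => (z : ℂ)) (congrFun hΓ t)
    simp only [Function.comp] at this
    have hp := Real.pi_pos
    have e : 2 * Real.pi * (Γ t / (2 * Real.pi)) = Γ t := by field_simp
    simp only [ee, ContinuousMap.coe_mk, e]
    exact this

open Classical in
/-- The lift starting at `0`. -/
def lft (u : C(unitInterval, ℂ)) : C(unitInterval, ℝ) :=
  if h : ∃ θ, IsLft u θ then h.choose else 0

lemma lft_spec {u : C(unitInterval, ℂ)} (h0 : u 0 = 1) (h1 : ∀ t, ‖u t‖ = 1) :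
    IsLft u (lft u) := by
  have h := exists_lft h0 h1
  rw [lft, dif_pos h]
  exact h.choose_spec

lemma ee_arcsin {w : ℂ} (h : ‖w‖ = 1) (hr : 0 < w.re) :
    ee (Real.arcsin w.im / (2 * Real.pi)) = w := by
  have hp := Real.pi_pos
  have e : 2 * Real.pi * (Real.arcsin w.im / (2 * Real.pi)) = Real.arcsin w.im := by
    field_simp
  have hn : w.re ^ 2 + w.im ^ 2 = 1 := by
    have := Complex.sq_norm w
    rw [h, Complex.normSq_apply] at this
    nlinarith
  rw [ee_eq, e, Complex.exp_mul_I]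
  apply Complex.ext
  · simp only [Complex.add_re, ← Complex.ofReal_cos, ← Complex.ofReal_sin, Complex.ofReal_re,
      Complex.mul_re, Complex.I_re, Complex.I_im, Complex.ofReal_im]
    rw [Real.cos_arcsin, show 1 - w.im ^ 2 = w.re ^ 2 by linarith, Real.sqrt_sq hr.le]
    ring
  · simp only [Complex.add_im, ← Complex.ofReal_cos, ← Complex.ofReal_sin, Complex.ofReal_re,
      Complex.mul_im, Complex.I_re, Complex.I_im, Complex.ofReal_im]
    rw [Real.sin_arcsin (by nlinarith) (by nlinarith)]
    ring

lemma lft_continuous {X : Type*} [TopologicalSpace X] (g : X → C(unitInterval, ℂ))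
    (hg : Continuous g) (h0 : ∀ x, g x 0 = 1) (h1 : ∀ x t, ‖g x t‖ = 1) :
    Continuous (fun x => lft (g x)) := by
  rw [continuous_iff_continuousAt]
  intro x
  have hgc : Continuous (fun p : X × unitInterval => g p.1 p.2) :=
    ContinuousMap.continuous_uncurry_of_continuous ⟨g, hg⟩
  let w : X → unitInterval → ℂ := fun y t => g y t * (starRingEnd ℂ) (g x t)
  let F : X → C(unitInterval, ℝ) := fun y =>
    ⟨fun t => lft (g x) t + Real.arcsin (w y t).im / (2 * Real.pi), by
      have : Continuous (fun t => w y t) := by fun_prop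
      fun_prop⟩
  have hF : Continuous F := by
    apply ContinuousMap.continuous_of_continuous_uncurry
    have : Continuous (fun p : X × unitInterval => w p.1 p.2) := by
      refine hgc.mul (Complex.continuous_conj.comp ?_)
      fun_prop
    change Continuous (fun p : X × unitInterval =>
      lft (g x) p.2 + Real.arcsin (w p.1 p.2).im / (2 * Real.pi))
    fun_prop
  have hev : ∀ᶠ y in 𝓝 x, F y = lft (g y) := by
    have hd : ∀ᶠ y in 𝓝 x, dist (g y) (g x) < 1 :=
      hg.continuousAt.eventually (Metric.ball_mem_nhds (g x) one_pos)
    filter_upwards [hd] with y hy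
    have hx := lft_spec (h0 x) (h1 x)
    refine IsLft.unique (u := g y) ⟨?_, ?_⟩ (lft_spec (h0 y) (h1 y))
    · simp [F, w, hx.1, h0]
    · intro t
      have hconj : g x t * (starRingEnd ℂ) (g x t) = 1 := by
        rw [Complex.mul_conj, Complex.normSq_eq_norm_sq, h1]; simp
      have hw1 : ‖w y t‖ = 1 := by simp [w, h1]
      have hwd : ‖w y t - 1‖ < 1 := by
        have : w y t - 1 = (g y t - g x t) * (starRingEnd ℂ) (g x t) := by
          rw [sub_mul, hconj]
        rw [this, norm_mul, RCLike.norm_conj, h1, mul_one, ← dist_eq_norm]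
        exact (ContinuousMap.dist_apply_le_dist t).trans_lt hy
      have hre : 0 < (w y t).re := by
        have := (Complex.abs_re_le_norm (w y t - 1)).trans_lt hwd
        rw [abs_lt] at this
        simp at this
        linarith
      simp only [F, ContinuousMap.coe_mk]
      rw [ee_add, ee_arcsin hw1 hre, hx.2]
      simp only [w]
      rw [mul_comm, mul_assoc, mul_comm ((starRingEnd ℂ) _), hconj, mul_one]
  exact (hF.continuousAt (x := x)).congr hev

/-- tent function -/
def tent (s : ℝ) : ℝ := max 0 (1 - |s|)

lemma tent_continuous : Continuous tent := by unfold tent; fun_prop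

lemma tent_zero : tent 0 = 1 := by simp [tent]

lemma tent_far {s : ℝ} (h : 1 ≤ |s|) : tent s = 0 := by
  simp [tent, h]

lemma tent_int {j : ℤ} (h : j ≠ 0) : tent j = 0 := by
  apply tent_far
  have := Int.one_le_abs h
  exact_mod_cast this

lemma tent_abs_le (s : ℝ) : |tent s| ≤ 1 := by
  unfold tent
  rw [abs_of_nonneg (le_max_left _ _)]
  have := abs_nonneg s
  exact max_le zero_le_one (by linarith)

/-- complex coordinate on the plane -/
def cpt (q : ℝ × ℝ) : ℂ := ⟨q.1, q.2⟩

lemma cpt_continuous : Continuous cpt := by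
  have : cpt = fun q : ℝ × ℝ => ((q.1 : ℂ) + (q.2 : ℂ) * Complex.I) := by
    funext q; apply Complex.ext <;> simp [cpt]
  rw [this]; fun_prop

/-- The retraction of the earring to the `n`-th circle, as a unit complex number. -/
def ang (n : ℕ) (q : ℝ × ℝ) : ℂ :=
  1 - n * (tent (2 * q.1 / (q.1 ^ 2 + q.2 ^ 2) - n) * cpt q)

lemma ang_continuous (n : ℕ) : Continuous (ang n) := by
  unfold ang
  refine continuous_const.sub (continuous_const.mul ?_)
  rw [continuous_iff_continuousAt]
  intro q
  by_cases hq : q = 0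
  · subst hq
    have h0 : cpt 0 = 0 := by apply Complex.ext <;> simp [cpt]
    unfold ContinuousAt
    simp only [h0, mul_zero]
    apply squeeze_zero_norm (a := fun q => ‖cpt q‖)
    · intro t
      rw [norm_mul, Complex.norm_real]
      exact mul_le_of_le_one_left (norm_nonneg _) (tent_abs_le _)
    · have := (cpt_continuous.norm).tendsto 0
      rwa [h0, norm_zero] at this
  · have hne : q.1 ^ 2 + q.2 ^ 2 ≠ 0 := by
      intro h
      apply hq
      apply Prod.ext
      · show q.1 = 0
        nlinarith [sq_nonneg q.1, sq_nonneg q.2]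
      · show q.2 = 0
        nlinarith [sq_nonneg q.1, sq_nonneg q.2]
    refine ContinuousAt.mul ?_ cpt_continuous.continuousAt
    refine Complex.continuous_ofReal.continuousAt.comp ?_
    refine ContinuousAt.comp (g := tent) tent_continuous.continuousAt ?_
    refine ContinuousAt.sub (ContinuousAt.div ?_ ?_ hne) continuousAt_const <;> fun_prop

lemma ang_of_mem {m n : ℕ} (hm : 1 ≤ m) {q : ℝ × ℝ} (hq : q ∈ circ m) :
    ang n q = if m = n then 1 - n * cpt q else 1 := by
  by_cases h0 : q = 0
  · subst h0
    have h0 : cpt 0 = 0 := by apply Complex.ext <;> simp [cpt]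
    simp [ang, h0]
  have hne : q.1 ^ 2 + q.2 ^ 2 ≠ 0 := by
    intro h
    apply h0
    apply Prod.ext
    · show q.1 = 0
      nlinarith [sq_nonneg q.1, sq_nonneg q.2]
    · show q.2 = 0
      nlinarith [sq_nonneg q.1, sq_nonneg q.2]
  have hmp : (0 : ℝ) < m := by exact_mod_cast hm
  have hd : 2 * q.1 / (q.1 ^ 2 + q.2 ^ 2) = m := by
    rw [div_eq_iff hne]
    simp only [circ, Set.mem_ofPred_eq] at hq
    have h3 : q.1 ^ 2 + q.2 ^ 2 = 2 * q.1 * (1 / m) := by linarith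
    rw [h3]; field_simp
  rw [ang, hd]
  split_ifs with h
  · subst h; simp [tent_zero]
  · have : ((m : ℝ) - n) = (((m : ℤ) - n : ℤ) : ℝ) := by push_cast; ring
    rw [this, tent_int (by omega)]
    simp

lemma norm_of_mem {m : ℕ} (hm : 1 ≤ m) {q : ℝ × ℝ} (hq : q ∈ circ m) :
    ‖1 - (m : ℂ) * cpt q‖ = 1 := by
  have hmp : (0 : ℝ) < m := by exact_mod_cast hm
  have h : ‖1 - (m : ℂ) * cpt q‖ ^ 2 = 1 := by
    rw [Complex.sq_norm, Complex.normSq_apply]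
    simp only [circ, Set.mem_ofPred_eq] at hq
    have h3 : q.1 ^ 2 + q.2 ^ 2 = 2 * q.1 * (1 / m) := by linarith
    have h4 : (m : ℝ) * (q.1 ^ 2 + q.2 ^ 2) = 2 * q.1 := by rw [h3]; field_simp
    simp [cpt]
    nlinarith
  have := norm_nonneg (1 - (m : ℂ) * cpt q)
  nlinarith

lemma HE_mem (z : HE) : ∃ m, 1 ≤ m ∧ (z : ℝ × ℝ) ∈ circ m := by
  obtain ⟨m, hm⟩ := Set.mem_iUnion.1 z.2
  obtain ⟨h1, h2⟩ := Set.mem_iUnion.1 hm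
  exact ⟨m, h1, h2⟩

lemma ang_norm (n : ℕ) (z : HE) : ‖ang n z‖ = 1 := by
  obtain ⟨m, hm, hz⟩ := HE_mem z
  rw [ang_of_mem hm hz]
  split_ifs with h
  · subst h; exact norm_of_mem hm hz
  · simp

lemma ang_hep (n : ℕ) : ang n hep = 1 := by
  have h0 : cpt (0, 0) = 0 := by apply Complex.ext <;> simp [cpt]
  simp [ang, hep, h0]

lemma ang_or {n : ℕ} (hn : 2 ≤ n) (z : HE) : ang n z = 1 ∨ ang 1 z = 1 := by
  obtain ⟨m, hm, hz⟩ := HE_mem z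
  by_cases h : m = n
  · right
    rw [ang_of_mem hm hz, if_neg (by omega)]
  · left
    rw [ang_of_mem hm hz, if_neg h]

/-- The combined function whose lift counts windings around the `n`-th circle at level `i`. -/
def gg (n : ℕ) (i : ℤ) (z : HE) (r : ℝ) : ℂ := 1 + tent (r - i) * (ang n z - 1)

lemma gg_norm {n : ℕ} (hn : 2 ≤ n) (i : ℤ) {z : HE} {r : ℝ} (h : ee r = ang 1 z) :
    ‖gg n i z r‖ = 1 := by
  rcases ang_or hn z with h1 | h1
  · simp [gg, h1]
  · rw [h1] at h
    obtain ⟨j, rfl⟩ := ee_eq_one h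
    unfold gg
    have : ((j : ℝ) - i) = ((j - i : ℤ) : ℝ) := by push_cast; ring
    rw [this]
    by_cases hj : j - i = 0
    · rw [hj]; simp [tent_zero, ang_norm]
    · rw [tent_int hj]; simp

/-- angle around first circle along a loop -/
def uu (γ : LoopSp HE hep) : C(unitInterval, ℂ) :=
  ⟨fun t => ang 1 (γ.1 t), (ang_continuous 1).comp (by fun_prop)⟩

lemma ev_continuous : Continuous (fun p : LoopSp HE hep × unitInterval => p.1.1 p.2) := by
  fun_prop

lemma uu_continuous : Continuous uu := by
  apply ContinuousMap.continuous_of_continuous_uncurry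
  exact (ang_continuous 1).comp (continuous_subtype_val.comp ev_continuous)

lemma uu_zero (γ : LoopSp HE hep) : uu γ 0 = 1 := by
  simp [uu, γ.2.1, ang_hep]

lemma uu_norm (γ : LoopSp HE hep) (t) : ‖uu γ t‖ = 1 := ang_norm 1 _

lemma uu_lft (γ : LoopSp HE hep) : IsLft (uu γ) (lft (uu γ)) := lft_spec (uu_zero γ) (uu_norm γ)

lemma th_continuous :
    Continuous (fun p : LoopSp HE hep × unitInterval => lft (uu p.1) p.2) :=
  ContinuousMap.continuous_uncurry_of_continuous
    ⟨_, lft_continuous uu uu_continuous uu_zero uu_norm⟩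

/-- level-`i` angle around the `n`-th circle along a loop -/
def vv (n : ℕ) (i : ℤ) (γ : LoopSp HE hep) : C(unitInterval, ℂ) :=
  ⟨fun t => gg n i (γ.1 t) (lft (uu γ) t), by
    have h1 : Continuous fun t => ang n (γ.1 t) := (ang_continuous n).comp (by fun_prop)
    have h2 := tent_continuous
    unfold gg
    fun_prop⟩

lemma vv_continuous (n : ℕ) (i : ℤ) : Continuous (vv n i) := by
  apply ContinuousMap.continuous_of_continuous_uncurry
  have h1 : Continuous (fun p : LoopSp HE hep × unitInterval => ang n (p.1.1 p.2)) :=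
    (ang_continuous n).comp (continuous_subtype_val.comp ev_continuous)
  have h2 := tent_continuous
  have h3 := th_continuous
  change Continuous (fun p : LoopSp HE hep × unitInterval =>
    gg n i (p.1.1 p.2) (lft (uu p.1) p.2))
  unfold gg
  fun_prop

lemma vv_zero (n : ℕ) (i : ℤ) (γ : LoopSp HE hep) : vv n i γ 0 = 1 := by
  simp [vv, gg, γ.2.1, ang_hep]

lemma vv_norm {n : ℕ} (hn : 2 ≤ n) (i : ℤ) (γ : LoopSp HE hep) (t) : ‖vv n i γ t‖ = 1 :=
  gg_norm hn i ((uu_lft γ).2 t)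

lemma vv_lft {n : ℕ} (hn : 2 ≤ n) (i : ℤ) (γ : LoopSp HE hep) :
    IsLft (vv n i γ) (lft (vv n i γ)) := lft_spec (vv_zero n i γ) (vv_norm hn i γ)

/-- winding number -/
def aa (n : ℕ) (i : ℤ) (γ : LoopSp HE hep) : ℝ := lft (vv n i γ) 1

lemma aa_continuous {n : ℕ} (hn : 2 ≤ n) (i : ℤ) : Continuous (aa n i) :=
  (continuous_eval_const (1 : unitInterval)).comp
    (lft_continuous (vv n i) (vv_continuous n i) (vv_zero n i) (vv_norm hn i))

lemma aa_int {n : ℕ} (hn : 2 ≤ n) (i : ℤ) (γ : LoopSp HE hep) : ∃ j : ℤ, aa n i γ = j := by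
  apply ee_eq_one
  rw [aa, (vv_lft hn i γ).2]
  simp [vv, gg, γ.2.2, ang_hep]

lemma aa_clopen {n : ℕ} (hn : 2 ≤ n) (i : ℤ) : IsClopen {γ | aa n i γ = 0} := by
  constructor
  · exact isClosed_eq (aa_continuous hn i) continuous_const
  · have : {γ | aa n i γ = 0} = {γ | |aa n i γ| < 1} := by
      ext γ
      obtain ⟨j, hj⟩ := aa_int hn i γ
      simp only [Set.mem_ofPred_eq, hj]
      constructor
      · intro h; simp [h]
      · intro h
        have : |j| < 1 := by exact_mod_cast h
        have : j = 0 := Int.abs_lt_one_iff.1 this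
        simp [this]
    rw [this]
    exact isOpen_lt (aa_continuous hn i).abs continuous_const

lemma aa_joined {n : ℕ} (hn : 2 ≤ n) (i : ℤ) {γ γ' : LoopSp HE hep} (h : Joined γ γ')
    (h0 : aa n i γ = 0) : aa n i γ' = 0 := by
  have h1 := (aa_clopen hn i).connectedComponent_subset h0
  exact h1 (pathComponent_subset_component _ h)

/-- Path to loop -/
def toL (p : Path hep hep) : LoopSp HE hep := ⟨p.toContinuousMap, p.source, p.target⟩

lemma toL_continuous : Continuous toL :=
  Continuous.subtype_mk continuous_induced_dom _

lemma toL_joined {p q : Path hep hep} (h : p.Homotopic q) : Joined (toL p) (toL q) := by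
  obtain ⟨F⟩ := h
  have hc : Continuous (fun t => F.eval t) := by
    apply Path.continuous_uncurry_iff.1
    exact F.continuous
  exact ⟨⟨⟨fun t => toL (F.eval t), toL_continuous.comp hc⟩, by simp, by simp⟩⟩

/-- The pointwise relation of being a lift. -/
def Rl (n : ℕ) (i : ℤ) (z : HE) (w : ℝ × ℝ) : Prop :=
  ee w.1 = ang 1 z ∧ ee w.2 = gg n i z w.1

/-- A path of lifts. -/
def RlP (n : ℕ) (i : ℤ) (p : Path hep hep) {x y : ℝ × ℝ} (Θ : Path x y) : Prop :=
  ∀ t, Rl n i (p t) (Θ t)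

lemma RlP.trans {n : ℕ} {i : ℤ} {p q : Path hep hep} {x y z : ℝ × ℝ} {Θ : Path x y}
    {Ξ : Path y z} (h1 : RlP n i p Θ) (h2 : RlP n i q Ξ) :
    RlP n i (p.trans q) (Θ.trans Ξ) := by
  intro t
  simp only [Path.trans_apply]
  split_ifs
  · exact h1 _
  · exact h2 _

lemma RlP.aa_eq {n : ℕ} {i : ℤ} {p : Path hep hep} {y : ℝ × ℝ} {Θ : Path (0, 0) y}
    (h : RlP n i p Θ) (hn : 2 ≤ n) : aa n i (toL p) = y.2 := by
  have e1 : (⟨fun t => (Θ t).1, by fun_prop⟩ : C(unitInterval, ℝ)) = lft (uu (toL p)) := by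
    refine IsLft.unique (u := uu (toL p)) ⟨by simp, fun t => (h t).1⟩ (uu_lft _)
  have e2 : (⟨fun t => (Θ t).2, by fun_prop⟩ : C(unitInterval, ℝ)) = lft (vv n i (toL p)) := by
    refine IsLft.unique (u := vv n i (toL p)) ⟨by simp, fun t => ?_⟩ (vv_lft hn i _)
    simp only [vv, ← e1]
    exact (h t).2
  rw [aa, ← e2]
  simp

/-- every path has a lift -/
lemma exists_RlP {n : ℕ} (hn : 2 ≤ n) (i : ℤ) (p : Path hep hep) :
    ∃ Θ : Path ((0 : ℝ), (0 : ℝ)) (lft (uu (toL p)) 1, aa n i (toL p)), RlP n i p Θ := by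
  refine ⟨⟨⟨fun t => (lft (uu (toL p)) t, lft (vv n i (toL p)) t), by fun_prop⟩, ?_, ?_⟩, ?_⟩
  · simp [(uu_lft (toL p)).1, (vv_lft hn i (toL p)).1]
  · simp [aa]
  · intro t
    exact ⟨(uu_lft (toL p)).2 t, (vv_lft hn i (toL p)).2 t⟩

/-- point on the `n`-th circle -/
def cp (n : ℕ) (s : ℝ) : ℝ × ℝ := ((1 - (ee s).re) / n, - (ee s).im / n)

lemma cp_mem {n : ℕ} (hn : 1 ≤ n) (s : ℝ) : cp n s ∈ circ n := by
  have hmp : (0 : ℝ) < n := by exact_mod_cast hn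
  have h := Complex.sq_norm (ee s)
  rw [ee_norm, Complex.normSq_apply] at h
  simp only [circ, cp, Set.mem_ofPred_eq]
  field_simp
  nlinarith

lemma cp_eq {n : ℕ} (hn : 1 ≤ n) (s : ℝ) : 1 - (n : ℂ) * cpt (cp n s) = ee s := by
  have hmp : (0 : ℝ) < n := by exact_mod_cast hn
  apply Complex.ext
  · simp [cpt, cp]; field_simp; ring
  · simp [cpt, cp]; field_simp

lemma cp_HE {n : ℕ} (hn : 1 ≤ n) (s : ℝ) : cp n s ∈ HE :=
  Set.mem_iUnion.2 ⟨n, Set.mem_iUnion.2 ⟨hn, cp_mem hn s⟩⟩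

lemma cp_int (n : ℕ) (K : ℤ) : cp n K = (0, 0) := by
  simp [cp, ee_int]

/-- the loop winding `K` times around the `n`-th circle -/
def cl (n : ℕ) (hn : 1 ≤ n) (K : ℤ) : Path hep hep where
  toFun t := ⟨cp n (K * t), cp_HE hn _⟩
  continuous_toFun := by
    refine Continuous.subtype_mk ?_ _
    have := ee_continuous
    unfold cp
    refine Continuous.prodMk ?_ ?_
    · exact (continuous_const.sub (Complex.continuous_re.comp (by fun_prop))).div_const _
    · exact (Complex.continuous_im.comp (by fun_prop)).neg.div_const _
  source' := by
    apply Subtype.ext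
    have := cp_int n 0
    simpa [hep] using this
  target' := by
    apply Subtype.ext
    have := cp_int n K
    simpa [hep] using this

lemma cl_ang (n : ℕ) (hn : 1 ≤ n) (K : ℤ) (m : ℕ) (t : unitInterval) :
    ang m (cl n hn K t) = if n = m then ee (K * t) else 1 := by
  have h : ((cl n hn K t : HE) : ℝ × ℝ) = cp n (K * t) := rfl
  rw [h, ang_of_mem hn (cp_mem hn _)]
  split_ifs with e
  · subst e; exact cp_eq hn _
  · rfl

/-- the straight path of lifts -/
def ln (x v : ℝ × ℝ) (y : ℝ × ℝ) (h : y = x + v) : Path x y where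
  toFun t := x + (t : ℝ) • v
  continuous_toFun := by fun_prop
  source' := by simp
  target' := by simp [h]

lemma aa_beta {n : ℕ} (hn : 2 ≤ n) (i : ℤ) (α : Path hep hep) (d : ℤ)
    (hd : lft (uu (toL α)) 1 = d) (h0 : aa n i (toL α) = 0) :
    aa n i (toL (α.trans ((cl 1 le_rfl (i - d)).trans
      ((cl n (by omega) 1).trans (cl 1 le_rfl (i - d)).symm)))) = 1 := by
  obtain ⟨Θ, hΘ⟩ := exists_RlP hn i α
  have ec : ∀ c : ℤ, RlP n i (cl 1 le_rfl (i - d))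
      (ln ((d : ℝ), (c : ℝ)) ((i - d : ℝ), 0) ((i : ℝ), (c : ℝ)) (by ext <;> simp)) := by
    intro c t
    have hx : (ln ((d : ℝ), (c : ℝ)) ((i - d : ℝ), 0) ((i : ℝ), (c : ℝ)) (by ext <;> simp)) t
      = ((d : ℝ) + (t : ℝ) * ((i : ℝ) - d), (c : ℝ)) := by
      ext <;> simp [ln]
    rw [hx]
    refine ⟨?_, ?_⟩
    · rw [cl_ang, if_pos rfl]
      simp only
      rw [ee_add, ee_int, one_mul, mul_comm]
      push_cast; rfl
    · simp only [gg]
      rw [cl_ang, if_neg (by omega), ee_int]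
      simp
  have ex : RlP n i (cl n (by omega) 1)
      (ln ((i : ℝ), ((0 : ℤ) : ℝ)) (0, 1) ((i : ℝ), ((1 : ℤ) : ℝ)) (by ext <;> simp)) := by
    intro t
    have hx : (ln ((i : ℝ), ((0 : ℤ) : ℝ)) (0, 1) ((i : ℝ), ((1 : ℤ) : ℝ)) (by ext <;> simp)) t
      = ((i : ℝ), (t : ℝ)) := by
      ext <;> simp [ln]
    rw [hx]
    refine ⟨?_, ?_⟩
    · rw [cl_ang, if_neg (by omega)]
      exact ee_int i
    · simp only [gg]
      rw [cl_ang, if_pos rfl]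
      simp [tent_zero]
  have es : RlP n i (cl 1 le_rfl (i - d)).symm
      (ln ((d : ℝ), ((1 : ℤ) : ℝ)) ((i - d : ℝ), 0) ((i : ℝ), ((1 : ℤ) : ℝ))
        (by ext <;> simp)).symm := by
    intro t
    exact ec 1 (unitInterval.symm t)
  have hend : (lft (uu (toL α)) 1, aa n i (toL α)) = ((d : ℝ), ((0 : ℤ) : ℝ)) := by
    rw [hd, h0]; simp
  have hΘ' : RlP n i α (Θ.cast rfl hend.symm) := hΘ
  have := (hΘ'.trans ((ec 0).trans (ex.trans es))).aa_eq hn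
  simpa using this

lemma cl_tendsto (α : Path hep hep) (K : ℤ) :
    Tendsto (fun n : ℕ => toL (α.trans ((cl 1 le_rfl K).trans
      ((cl (n + 2) (by omega) 1).trans (cl 1 le_rfl K).symm)))) atTop
      (𝓝 (toL (α.trans ((cl 1 le_rfl K).trans
      ((Path.refl hep).trans (cl 1 le_rfl K).symm))))) := by
  have h1 : Tendsto (fun n : ℕ => cl (n + 2) (by omega) 1) atTop (𝓝 (Path.refl hep)) := by
    rw [nhds_induced, tendsto_comap_iff, tendsto_iff_dist_tendsto_zero]
    have hb : Tendsto (fun n : ℕ => 2 / ((n : ℝ) + 2)) atTop (𝓝 0) :=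
      Tendsto.const_div_atTop (tendsto_atTop_add_const_right _ _ tendsto_natCast_atTop_atTop) 2
    refine squeeze_zero (fun _ => dist_nonneg) (fun n => ?_) hb
    have hp : (0 : ℝ) < (n : ℝ) + 2 := by positivity
    rw [ContinuousMap.dist_le (by positivity)]
    intro t
    change dist (cp (n + 2) ((1 : ℤ) * t)) ((0 : ℝ), (0 : ℝ)) ≤ _
    have hr := Complex.abs_re_le_norm (ee ((1 : ℤ) * t))
    have hi := Complex.abs_im_le_norm (ee ((1 : ℤ) * t))
    rw [ee_norm] at hr hi
    rw [abs_le] at hr hi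
    rw [Prod.dist_eq]
    simp only [cp, Real.dist_eq, sub_zero, abs_div]
    push_cast
    rw [abs_of_pos hp]
    rw [Int.cast_one] at hr hi
    refine max_le ?_ ?_ <;> refine div_le_div_of_nonneg_right ?_ hp.le <;> rw [abs_le] <;>
      constructor <;> linarith
  refine (toL_continuous.tendsto _).comp ?_
  have c1 : Continuous (fun p : Path hep hep => α.trans ((cl 1 le_rfl K).trans
      (p.trans (cl 1 le_rfl K).symm))) := by
    fun_prop
  exact (c1.tendsto _).comp h1

lemma limit_homotopic (α c : Path hep hep) :
    α.Homotopic (α.trans (c.trans ((Path.refl hep).trans c.symm))) := by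
  have h1 : (c.trans ((Path.refl hep).trans c.symm)).Homotopic (Path.refl hep) := by
    refine Path.Homotopic.trans ?_ ⟨(Path.Homotopy.reflTransSymm c).symm⟩
    exact Path.Homotopic.hcomp (Path.Homotopic.refl c) ⟨Path.Homotopy.reflTrans _⟩
  refine Path.Homotopic.symm ?_
  exact Path.Homotopic.trans (Path.Homotopic.hcomp (Path.Homotopic.refl α) h1)
    ⟨Path.Homotopy.transRefl _⟩

/-- The closed sets in the Baire argument, at the level of loops. -/
def AL (k : ℕ) : Set (LoopSp HE hep) := {γ | ∀ n, 2 ≤ n → ∀ i : ℤ, k ≤ i → aa n i γ = 0}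

lemma AL_closed (k : ℕ) : IsClosed (AL k) := by
  have : AL k = ⋂ (n : ℕ) (_ : 2 ≤ n) (i : ℤ) (_ : (k : ℤ) ≤ i), {γ | aa n i γ = 0} := by
    ext γ; simp [AL]
  rw [this]
  exact isClosed_iInter fun n => isClosed_iInter fun hn => isClosed_iInter fun i =>
    isClosed_iInter fun _ => (aa_clopen hn i).1

lemma AL_union (γ : LoopSp HE hep) : ∃ k, γ ∈ AL k := by
  obtain ⟨M, hM⟩ := (isCompact_range (lft (uu γ)).continuous).bddAbove
  obtain ⟨k, hk⟩ := exists_nat_gt (M + 1)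
  refine ⟨k, fun n hn i hi => ?_⟩
  have : lft (vv n i γ) = 0 := by
    refine IsLft.unique (vv_lft hn i γ) ⟨rfl, fun t => ?_⟩
    have h1 : lft (uu γ) t ≤ M := hM ⟨t, rfl⟩
    have h2 : (k : ℝ) ≤ i := by exact_mod_cast hi
    simp only [vv, gg, ContinuousMap.coe_mk, ContinuousMap.zero_apply, ee_zero]
    rw [tent_far]
    · simp
    · rw [abs_of_neg (by linarith)]; linarith
  rw [aa, this]; rfl

/-- The closed sets in the Baire argument. -/
def AQ (k : ℕ) : Set (TopPi1 HE hep) := {x | ∀ γ : LoopSp HE hep, Quotient.mk _ γ = x → γ ∈ AL k}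

lemma AQ_preimage (k : ℕ) :
    (Quotient.mk (pathSetoid (LoopSp HE hep))) ⁻¹' AQ k = AL k := by
  ext γ
  constructor
  · intro h; exact h γ rfl
  · intro h γ' hγ' n hn i hi
    have hj : Joined γ' γ := Quotient.exact hγ'
    exact aa_joined hn i hj.symm (h n hn i hi)

lemma AQ_closed (k : ℕ) : IsClosed (AQ k) := by
  have := (isQuotientMap_quotient_mk' (s := pathSetoid (LoopSp HE hep))).isClosed_preimage
    (s := AQ k)
  rw [← this]
  have h := AL_closed k
  rw [← AQ_preimage] at h
  exact h

lemma AQ_interior (k : ℕ) : interior (AQ k) = ∅ := by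
  by_contra hne
  obtain ⟨x, hx⟩ := Set.nonempty_iff_ne_empty.2 hne
  obtain ⟨γ, rfl⟩ := Quotient.exists_rep x
  let α : Path hep hep := ⟨γ.1, γ.2.1, γ.2.2⟩
  have hα : toL α = γ := rfl
  let V := (Quotient.mk (pathSetoid (LoopSp HE hep))) ⁻¹' interior (AQ k)
  have hV : IsOpen V := isOpen_interior.preimage continuous_quotient_mk'
  have hVA : V ⊆ AL k := by
    rw [← AQ_preimage]
    exact Set.preimage_mono interior_subset
  obtain ⟨d, hd⟩ : ∃ d : ℤ, lft (uu (toL α)) 1 = d := by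
    apply ee_eq_one
    rw [(uu_lft (toL α)).2]
    simp [uu, (toL α).2.2, ang_hep]
  have hγ : γ ∈ AL k := hVA hx
  have hlim : toL (α.trans ((cl 1 le_rfl (k - d)).trans
      ((Path.refl hep).trans (cl 1 le_rfl (k - d)).symm))) ∈ V := by
    have hj := toL_joined (limit_homotopic α (cl 1 le_rfl (k - d)))
    have he : Quotient.mk (pathSetoid (LoopSp HE hep)) (toL α) = _ := Quotient.sound hj
    change Quotient.mk (pathSetoid (LoopSp HE hep)) _ ∈ interior (AQ k)
    rw [← he]
    exact hx
  obtain ⟨n, hn⟩ := ((cl_tendsto α (k - d)).eventually (hV.mem_nhds hlim)).exists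
  have h1 := hVA hn (n + 2) (by omega) k le_rfl
  have h2 := aa_beta (n := n + 2) (by omega) k α d hd (hγ (n + 2) (by omega) k le_rfl)
  rw [h2] at h1
  exact one_ne_zero h1

lemma not_baire : ¬ BaireSpace (TopPi1 HE hep) := by
  intro hB
  haveI : Nonempty (TopPi1 HE hep) := ⟨Quotient.mk _ (toL (Path.refl hep))⟩
  obtain ⟨k, hk⟩ := nonempty_interior_of_iUnion_of_closed (f := AQ) AQ_closed (by
    rw [Set.eq_univ_iff_forall]
    intro x
    obtain ⟨γ, rfl⟩ := Quotient.exists_rep x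
    obtain ⟨k, hk⟩ := AL_union γ
    rw [← AQ_preimage] at hk
    exact Set.mem_iUnion.2 ⟨k, hk⟩)
  rw [AQ_interior] at hk
  exact Set.not_nonempty_empty hk

/-- The topological fundamental group `π₁(HE, p)` of the Hawaiian
earring, endowed with the quotient topology, admits no complete metric compatible with
its topology; that is, it is not completely metrizable. -/
theorem topPi1_HE_not_completely_metrizable :
    ¬ ∃ m : MetricSpace (TopPi1 HE hep),
        m.toUniformSpace.toTopologicalSpace = instTopologicalSpaceQuotient ∧
        @CompleteSpace (TopPi1 HE hep) m.toUniformSpace := by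
  rintro ⟨m, hm, hc⟩
  have hB : @BaireSpace (TopPi1 HE hep) m.toUniformSpace.toTopologicalSpace := by
    letI := m
    infer_instance
  rw [hm] at hB
  exact not_baire hB

end
end

section
/- The Hawaiian earring HE cannot be embedded as a retract of any space whose topological fundamental group admits a complete metric: if Y is a topological space, h : HE → Y is a topological embedding, and r : Y → h(HE) is a continuous retraction (r(y) = y for all y ∈ h(HE)), then the topological fundamental group π₁(Y, h(p)), endowed with the quotient topology, admits no complete metric compatible with its topology. -/
noncomputable section

open Set Filter Topology

/-! ### The combinatorial cocycle on the figure eight -/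

abbrev Gam : Type := ℤ ≃ᵢ ℤ

def aI : Gam := IsometryEquiv.neg ℤ
def bI : Gam := IsometryEquiv.subLeft (1 : ℤ)

lemma aI_apply (x : ℤ) : aI x = -x := by simp [aI]
lemma bI_apply (x : ℤ) : bI x = 1 - x := by simp [bI]
lemma aI_mul : aI * aI = 1 := by
  ext x; show aI (aI x) = x; simp [aI_apply]
lemma bI_mul : bI * bI = 1 := by
  ext x; show bI (bI x) = x; simp [bI_apply]

def fig8 : Set (ℝ × ℝ) := {w | w.1 ^ 2 + w.2 ^ 2 = 2 * |w.1|}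

def clo (w w' : ℝ × ℝ) : Prop := |w.1 - w'.1| < 1 / 4 ∧ |w.2 - w'.2| < 1 / 4

lemma clo_of_dist {w w' : ℝ × ℝ} (h : dist w w' < 1 / 4) : clo w w' := by
  rw [Prod.dist_eq, max_lt_iff, Real.dist_eq, Real.dist_eq] at h
  exact h

open Classical in
def cc (w w' : ℝ × ℝ) : Gam :=
  if 1 ≤ w.1 ∧ 1 ≤ w'.1 ∧ ¬(w.2 < 0 ↔ w'.2 < 0) then bI
  else if w.1 ≤ -1 ∧ w'.1 ≤ -1 ∧ ¬(w.2 < 0 ↔ w'.2 < 0) then aI else 1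

lemma cc_self (w : ℝ × ℝ) : cc w w = 1 := by simp [cc]

lemma same_sign {w w' : ℝ × ℝ} (hw : w ∈ fig8) (hw' : w' ∈ fig8) (h : clo w w')
    (h1 : 1 ≤ |w.1|) (h1' : 1 ≤ |w'.1|) (h2 : |w.1| < 3 / 2) (h2' : |w'.1| < 3 / 2) :
    (w.2 < 0 ↔ w'.2 < 0) := by
  simp only [fig8, mem_ofPred_eq] at hw hw'
  rw [← sq_abs w.1] at hw
  rw [← sq_abs w'.1] at hw'
  have e := abs_lt.1 h.2
  generalize |w.1| = x at *
  generalize |w'.1| = x' at *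
  constructor
  · intro h3; by_contra h4; push Not at h4
    have : w'.2 < 1/4 := by linarith
    nlinarith
  · intro h3; by_contra h4; push Not at h4
    have : w.2 < 1/4 := by linarith
    nlinarith

lemma cc_near {w w' : ℝ × ℝ} (hw : w ∈ fig8) (hw' : w' ∈ fig8) (h : clo w w')
    (h2 : |w.1| < 3 / 2) (h2' : |w'.1| < 3 / 2) : cc w w' = 1 := by
  unfold cc
  rw [if_neg, if_neg]
  · rintro ⟨h3, h4, h5⟩
    exact h5 (same_sign hw hw' h (by rw [le_abs]; right; linarith) (by rw [le_abs]; right; linarith) h2 h2')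
  · rintro ⟨h3, h4, h5⟩
    exact h5 (same_sign hw hw' h (by rw [le_abs]; left; linarith) (by rw [le_abs]; left; linarith) h2 h2')

lemma cc_right {w w' w'' : ℝ × ℝ} (h : 1 ≤ w.1) (h' : 1 ≤ w'.1) (h'' : 1 ≤ w''.1) :
    cc w w' * cc w' w'' = cc w w'' := by
  have n : ¬ w.1 ≤ -1 := by linarith
  have n' : ¬ w'.1 ≤ -1 := by linarith
  unfold cc
  by_cases a : w.2 < 0 <;> by_cases b : w'.2 < 0 <;> by_cases c : w''.2 < 0 <;>
    simp [a, b, c, h, h', h'', n, n', bI_mul]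

lemma cc_left {w w' w'' : ℝ × ℝ} (h : w.1 ≤ -1) (h' : w'.1 ≤ -1) (h'' : w''.1 ≤ -1) :
    cc w w' * cc w' w'' = cc w w'' := by
  have n : ¬ 1 ≤ w.1 := by linarith
  have n' : ¬ 1 ≤ w'.1 := by linarith
  unfold cc
  by_cases a : w.2 < 0 <;> by_cases b : w'.2 < 0 <;> by_cases c : w''.2 < 0 <;>
    simp [a, b, c, h, h', h'', n, n', aI_mul]

lemma cc_cocycle {x y z : ℝ × ℝ} (hx : x ∈ fig8) (hy : y ∈ fig8) (hz : z ∈ fig8)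
    (hxy : clo x y) (hyz : clo y z) (hxz : clo x z) : cc x y * cc y z = cc x z := by
  have e1 := abs_lt.1 hxy.1
  have e2 := abs_lt.1 hyz.1
  have e3 := abs_lt.1 hxz.1
  by_cases h1 : 5/4 ≤ x.1 ∨ 5/4 ≤ y.1 ∨ 5/4 ≤ z.1
  · apply cc_right <;> rcases h1 with h | h | h <;> linarith
  by_cases h2 : x.1 ≤ -(5/4) ∨ y.1 ≤ -(5/4) ∨ z.1 ≤ -(5/4)
  · apply cc_left <;> rcases h2 with h | h | h <;> linarith
  push Not at h1 h2
  have ax : |x.1| < 3/2 := abs_lt.2 ⟨by linarith, by linarith⟩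
  have ay : |y.1| < 3/2 := abs_lt.2 ⟨by linarith, by linarith⟩
  have az : |z.1| < 3/2 := abs_lt.2 ⟨by linarith, by linarith⟩
  rw [cc_near hx hy hxy ax ay, cc_near hy hz hyz ay az, cc_near hx hz hxz ax az, one_mul]

/-! ### Discrete products -/

def Pw (s : ℕ → ℝ × ℝ) : ℕ → Gam
  | 0 => 1
  | n + 1 => Pw s n * cc (s n) (s (n + 1))

lemma Pw_add (s : ℕ → ℝ × ℝ) (m n : ℕ) :
    Pw s (m + n) = Pw s m * Pw (fun i => s (m + i)) n := by
  induction n with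
  | zero => simp [Pw]
  | succ n ih => rw [← add_assoc, Pw, ih, Pw, mul_assoc]; rfl

lemma Pw_congr {s t : ℕ → ℝ × ℝ} {n : ℕ} (h : ∀ i ≤ n, s i = t i) : Pw s n = Pw t n := by
  induction n with
  | zero => rfl
  | succ n ih =>
    rw [Pw, Pw, ih (fun i hi => h i (by omega)), h n (by omega), h (n+1) le_rfl]

lemma Pw_double {s : ℕ → ℝ × ℝ} {n : ℕ}
    (h : ∀ i < n, cc (s (2*i)) (s (2*i+1)) * cc (s (2*i+1)) (s (2*i+2)) = cc (s (2*i)) (s (2*i+2))) :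
    Pw s (2*n) = Pw (fun i => s (2*i)) n := by
  induction n with
  | zero => rfl
  | succ n ih =>
    rw [show 2 * (n+1) = 2*n+1+1 by ring, Pw, Pw, Pw, ih (fun i hi => h i (by omega)), mul_assoc,
      h n (by omega)]
    rfl

lemma Pw_ladder {s t : ℕ → ℝ × ℝ} {n : ℕ}
    (h : ∀ i < n, cc (s i) (s (i+1)) * cc (s (i+1)) (t (i+1)) = cc (s i) (t i) * cc (t i) (t (i+1))) :
    Pw s n * cc (s n) (t n) = cc (s 0) (t 0) * Pw t n := by
  induction n with
  | zero => simp [Pw]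
  | succ n ih =>
    rw [Pw, Pw, mul_assoc, h n (by omega), ← mul_assoc, ih (fun i hi => h i (by omega)), mul_assoc]

lemma Pw_cobdry {s : ℕ → ℝ × ℝ} {n : ℕ} (K : ℕ → Gam)
    (h : ∀ i < n, cc (s i) (s (i+1)) = (K i)⁻¹ * K (i+1)) :
    Pw s n = (K 0)⁻¹ * K n := by
  induction n with
  | zero => simp [Pw]
  | succ n ih => rw [Pw, ih (fun i hi => h i (by omega)), h n (by omega)]; group

/-- length -/
def len (g : Gam) : ℕ := (g 0).natAbs

lemma natAbs_sub_apply (g : Gam) (x y : ℤ) : (g x - g y).natAbs = (x - y).natAbs := by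
  have := g.isometry.dist_eq x y
  rw [Int.dist_eq', Int.dist_eq'] at this
  have h2 : |g x - g y| = |x - y| := by exact_mod_cast this
  rw [Int.abs_eq_natAbs, Int.abs_eq_natAbs] at h2
  exact_mod_cast h2

lemma len_mul (g h : Gam) : len (g * h) ≤ len g + len h := by
  have := natAbs_sub_apply g (h 0) 0
  have e : (g * h) 0 = g (h 0) := rfl
  unfold len
  rw [e]
  omega

lemma len_blocks (s : ℕ → ℝ × ℝ) (A B : ℕ) (h : ∀ i < A, len (Pw (fun j => s (i * B + j)) B) ≤ 1) :
    len (Pw s (A * B)) ≤ A := by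
  induction A with
  | zero => simp [Pw, len]
  | succ A ih =>
    rw [Nat.succ_mul, Pw_add]
    have := len_mul (Pw s (A*B)) (Pw (fun j => s (A * B + j)) B)
    have := h A (by omega)
    have := ih (fun i hi => h i (by omega))
    omega

/-- Block staying in the right-hand far region. -/
lemma len_block_far {s : ℕ → ℝ × ℝ} {n : ℕ} (h : ∀ i ≤ n, 1 ≤ (s i).1) : len (Pw s n) ≤ 1 := by
  have : Pw s n = cc (s 0) (s n) := by
    induction n with
    | zero => simp [Pw, cc_self]
    | succ n ih =>
      rw [Pw, ih (fun i hi => h i (by omega))]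
      exact cc_right (h _ (by omega)) (h _ (by omega)) (h _ (by omega))
  rw [this]
  have h0 := h 0 (by omega)
  unfold cc
  split_ifs <;> simp [len, bI_apply, aI_apply]

lemma len_block_near {s : ℕ → ℝ × ℝ} {n : ℕ} (hf : ∀ i ≤ n, s i ∈ fig8)
    (hc : ∀ i < n, clo (s i) (s (i+1))) (h : ∀ i ≤ n, (s i).1 < 3/2) : len (Pw s n) ≤ 1 := by
  have : (Pw s n) 0 = 0 := by
    induction n with
    | zero => simp [Pw]
    | succ n ih =>
      have e : cc (s n) (s (n+1)) 0 = 0 := by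
        unfold cc
        rw [if_neg]
        · split_ifs <;> simp [aI_apply]
        · rintro ⟨h3, h4, h5⟩
          refine h5 (same_sign (hf _ (by omega)) (hf _ (by omega)) (hc _ (by omega)) ?_ ?_ ?_ ?_)
          · rw [le_abs]; left; exact h3
          · rw [le_abs]; left; exact h4
          · rw [abs_of_nonneg (by linarith)]; exact h _ (by omega)
          · rw [abs_of_nonneg (by linarith)]; exact h _ (by omega)
      rw [Pw]
      show Pw s n (cc (s n) (s (n+1)) 0) = 0
      rw [e]
      exact ih (fun i hi => hf i (by omega)) (fun i hi => hc i (by omega)) (fun i hi => h i (by omega))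
  simp [len, this]

/-! ### The invariant of a path in the figure eight -/

def Dn (γ : ℝ → ℝ × ℝ) (n : ℕ) : Gam := Pw (fun i => γ ((i : ℝ) / 2 ^ n)) (2 ^ n)

def Msh (γ : ℝ → ℝ × ℝ) (ε : ℝ) (n : ℕ) : Prop :=
  ∀ s ∈ Icc (0 : ℝ) 1, ∀ t ∈ Icc (0 : ℝ) 1, |s - t| ≤ 1 / 2 ^ n → dist (γ s) (γ t) < ε

lemma msh_eventually {γ : ℝ → ℝ × ℝ} (hγ : Continuous γ) {ε : ℝ} (hε : 0 < ε) :
    ∀ᶠ n in atTop, Msh γ ε n := by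
  have hu : UniformContinuousOn γ (Icc (0 : ℝ) 1) :=
    isCompact_Icc.uniformContinuousOn_of_continuous hγ.continuousOn
  obtain ⟨δ, hδ, h⟩ := Metric.uniformContinuousOn_iff.1 hu ε hε
  have ht : Tendsto (fun n : ℕ => (1 / 2 : ℝ) ^ n) atTop (𝓝 0) :=
    tendsto_pow_atTop_nhds_zero_of_lt_one (by norm_num) (by norm_num)
  filter_upwards [ht.eventually (gt_mem_nhds hδ)] with n hn s hs t ht hst
  apply h s hs t ht
  rw [Real.dist_eq]
  rw [one_div_pow] at hn
  linarith

lemma msh_mono {γ : ℝ → ℝ × ℝ} {ε : ℝ} {n m : ℕ} (h : Msh γ ε n) (hm : n ≤ m) : Msh γ ε m := by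
  intro s hs t ht hst
  refine h s hs t ht (hst.trans ?_)
  exact one_div_le_one_div_of_le (by positivity) (pow_le_pow_right₀ (by norm_num) hm)

lemma grid_mem {i n : ℕ} (h : i ≤ 2 ^ n) : ((i : ℝ) / 2 ^ n) ∈ Icc (0 : ℝ) 1 := by
  refine ⟨by positivity, ?_⟩
  rw [div_le_one (by positivity)]
  exact_mod_cast h

lemma grid_step (i n : ℕ) : |(i : ℝ) / 2 ^ n - ((i + 1 : ℕ) : ℝ) / 2 ^ n| ≤ 1 / 2 ^ n := by
  rw [← sub_div, abs_div]
  simp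

lemma Dn_stable {γ : ℝ → ℝ × ℝ} (hf : ∀ t, γ t ∈ fig8) {n : ℕ} (hm : Msh γ (1/4) n) :
    Dn γ (n+1) = Dn γ n := by
  unfold Dn
  rw [pow_succ' (2:ℕ) n, Pw_double]
  · apply Pw_congr
    intro i _
    congr 1
    push_cast
    field_simp
    ring
  · intro i hi
    have hm' := msh_mono hm (Nat.le_succ n)
    have e2 : (2:ℝ) ^ (n+1) = 2 * 2 ^ n := pow_succ' 2 n
    have h2 : 2 ^ (n+1) = 2 * 2 ^ n := pow_succ' 2 n
    have m0 : 2 * i ≤ 2 ^ (n+1) := by omega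
    have m1 : 2 * i + 1 ≤ 2 ^ (n+1) := by omega
    have m2 : 2 * i + 2 ≤ 2 ^ (n+1) := by omega
    refine cc_cocycle (hf _) (hf _) (hf _) (clo_of_dist ?_) (clo_of_dist ?_) (clo_of_dist ?_)
    · exact hm' _ (grid_mem m0) _ (grid_mem m1) (grid_step _ _)
    · exact hm' _ (grid_mem m1) _ (grid_mem m2) (grid_step _ _)
    · refine hm _ (grid_mem m0) _ (grid_mem m2) ?_
      rw [← sub_div, abs_div]
      push_cast
      rw [show (2 * (i:ℝ) - (2 * i + 2)) = -2 by ring, e2, abs_of_pos (by positivity : (0:ℝ) < 2 * 2 ^ n)]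
      norm_num
      field_simp
      norm_num

lemma Dn_const {γ : ℝ → ℝ × ℝ} (hf : ∀ t, γ t ∈ fig8) {n : ℕ} (hm : Msh γ (1/4) n) (m : ℕ)
    (hnm : n ≤ m) : Dn γ m = Dn γ n := by
  induction m, hnm using Nat.le_induction with
  | base => rfl
  | succ m hmn ih => rw [Dn_stable hf (msh_mono hm hmn), ih]

def Phi (γ : ℝ → ℝ × ℝ) : Gam := Classical.epsilon (fun v => ∀ᶠ n in atTop, Dn γ n = v)

lemma Phi_spec {γ : ℝ → ℝ × ℝ} (hγ : Continuous γ) (hf : ∀ t, γ t ∈ fig8) :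
    ∀ᶠ n in atTop, Dn γ n = Phi γ := by
  obtain ⟨n, hn⟩ := (msh_eventually hγ (show (0:ℝ) < 1/4 by norm_num)).exists
  exact Classical.epsilon_spec (p := fun v => ∀ᶠ n in atTop, Dn γ n = v)
    ⟨Dn γ n, by filter_upwards [eventually_ge_atTop n] with m hm using Dn_const hf hn m hm⟩

lemma Phi_eq {γ : ℝ → ℝ × ℝ} (hγ : Continuous γ) (hf : ∀ t, γ t ∈ fig8) {v : Gam}
    (h : ∀ᶠ n in atTop, Dn γ n = v) : Phi γ = v := by
  obtain ⟨n, h1, h2⟩ := ((Phi_spec hγ hf).and h).exists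
  rw [← h1, h2]

lemma Phi_close {γ γ' : ℝ → ℝ × ℝ} (hγ : Continuous γ) (hf : ∀ t, γ t ∈ fig8)
    (hγ' : Continuous γ') (hf' : ∀ t, γ' t ∈ fig8)
    (hd : ∀ t ∈ Icc (0:ℝ) 1, dist (γ t) (γ' t) < 1/12) (h0 : γ 0 = γ' 0) (h1 : γ 1 = γ' 1) :
    Phi γ = Phi γ' := by
  apply Phi_eq hγ hf
  filter_upwards [Phi_spec hγ' hf', msh_eventually hγ (show (0:ℝ) < 1/12 by norm_num),
    msh_eventually hγ' (show (0:ℝ) < 1/12 by norm_num)] with n hn hm hm'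
  rw [← hn]
  unfold Dn
  have key := Pw_ladder (s := fun i => γ ((i : ℝ) / 2 ^ n)) (t := fun i => γ' ((i : ℝ) / 2 ^ n))
    (n := 2 ^ n) ?_
  · simpa [h0, h1, cc_self] using key
  · intro i hi
    have g0 := grid_mem (n := n) (i := i) (by omega)
    have g1 := grid_mem (n := n) (i := i + 1) (by omega)
    have a1 := hm _ g0 _ g1 (grid_step _ _)
    have a2 := hm' _ g0 _ g1 (grid_step _ _)
    have a3 := hd _ g0
    have a4 := hd _ g1
    have a5 := dist_triangle (γ ((i : ℝ) / 2 ^ n)) (γ (((i + 1 : ℕ) : ℝ) / 2 ^ n))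
      (γ' (((i + 1 : ℕ) : ℝ) / 2 ^ n))
    beta_reduce
    rw [cc_cocycle (hf _) (hf _) (hf' _), cc_cocycle (hf _) (hf' _) (hf' _)] <;>
      apply clo_of_dist <;> linarith

lemma Phi_trans {γ γ₁ γ₂ : ℝ → ℝ × ℝ} (hγ : Continuous γ) (hf : ∀ t, γ t ∈ fig8)
    (hγ₁ : Continuous γ₁) (hf₁ : ∀ t, γ₁ t ∈ fig8)
    (hγ₂ : Continuous γ₂) (hf₂ : ∀ t, γ₂ t ∈ fig8)
    (h1 : ∀ t ≤ (1/2 : ℝ), γ t = γ₁ (2 * t)) (h2 : ∀ t, (1/2 : ℝ) ≤ t → γ t = γ₂ (2 * t - 1)) :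
    Phi γ = Phi γ₁ * Phi γ₂ := by
  obtain ⟨n, hn, hn1, hn2⟩ := (((tendsto_add_atTop_nat 1).eventually (Phi_spec hγ hf)).and
    ((Phi_spec hγ₁ hf₁).and (Phi_spec hγ₂ hf₂))).exists
  rw [← hn, ← hn1, ← hn2]
  unfold Dn
  rw [show 2 ^ (n+1) = 2 ^ n + 2 ^ n by ring, Pw_add]
  have e2 : (2:ℝ) ^ (n+1) = 2 * 2 ^ n := pow_succ' 2 n
  have hp : (0:ℝ) < 2 ^ n := by positivity
  congr 1
  · apply Pw_congr
    intro i hi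
    have hi' : (i:ℝ) ≤ 2 ^ n := by exact_mod_cast hi
    rw [h1]
    · congr 1; rw [e2]; field_simp
    · rw [e2, div_le_iff₀ (by positivity)]; linarith
  · apply Pw_congr
    intro i hi
    rw [h2]
    · congr 1; rw [e2]; push_cast; field_simp; ring
    · rw [e2, le_div_iff₀ (by positivity)]; push_cast
      have : (0:ℝ) ≤ i := by positivity
      linarith

lemma Phi_bound {γ : ℝ → ℝ × ℝ} (hγ : Continuous γ) (hf : ∀ t, γ t ∈ fig8) (m : ℕ)
    (h : ∀ i : ℕ, i < 2 ^ m → (∀ t ∈ Icc ((i:ℝ) / 2 ^ m) ((i + 1 : ℝ) / 2 ^ m), 1 ≤ (γ t).1) ∨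
      (∀ t ∈ Icc ((i:ℝ) / 2 ^ m) ((i + 1 : ℝ) / 2 ^ m), (γ t).1 < 3/2)) :
    len (Phi γ) ≤ 2 ^ m := by
  obtain ⟨n, hn, hms, hnm⟩ := ((Phi_spec hγ hf).and ((msh_eventually hγ
    (show (0:ℝ) < 1/4 by norm_num)).and (eventually_ge_atTop m))).exists
  rw [← hn]
  obtain ⟨d, rfl⟩ := Nat.exists_eq_add_of_le hnm
  unfold Dn
  rw [pow_add (2:ℕ) m d]
  apply len_blocks
  intro i hi
  have hmem : ∀ j ≤ 2 ^ d, (((i * 2 ^ d + j : ℕ) : ℝ) / 2 ^ (m + d)) ∈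
      Icc ((i:ℝ) / 2 ^ m) ((i + 1 : ℝ) / 2 ^ m) := by
    intro j hj
    have hj' : (j:ℝ) ≤ 2 ^ d := by exact_mod_cast hj
    have : (0:ℝ) ≤ j := by positivity
    rw [pow_add]
    push_cast
    constructor
    · rw [div_le_div_iff₀ (by positivity) (by positivity)]
      nlinarith [pow_pos (two_pos : (0:ℝ) < 2) m]
    · rw [div_le_div_iff₀ (by positivity) (by positivity)]
      nlinarith [pow_pos (two_pos : (0:ℝ) < 2) m]
  rcases h i hi with h | h
  · exact len_block_far (fun j hj => h _ (hmem j hj))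
  · refine len_block_near (fun j _ => hf _) (fun j hj => clo_of_dist ?_) (fun j hj => h _ (hmem j hj))
    have hb : (i + 1) * 2 ^ d ≤ 2 ^ m * 2 ^ d := Nat.mul_le_mul_right _ hi
    rw [Nat.succ_mul, ← pow_add] at hb
    exact hms _ (grid_mem (by omega)) _ (grid_mem (by omega)) (grid_step _ _)

lemma circle_facts {t : ℝ} (ht : t ∈ Icc (0:ℝ) 1) :
    (t ≤ 1/2 → 0 ≤ Real.sin (2 * Real.pi * t)) ∧
    (1/2 < t → t < 1 → Real.sin (2 * Real.pi * t) < 0) ∧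
    (1/4 ≤ t → t ≤ 3/4 → 1 ≤ 1 - Real.cos (2 * Real.pi * t)) ∧
    (t = 1 → 1 - Real.cos (2 * Real.pi * t) = 0) := by
  have hp := Real.pi_pos
  obtain ⟨h0, h1⟩ := ht
  refine ⟨fun h => ?_, fun h h' => ?_, fun h h' => ?_, fun h => ?_⟩
  · apply Real.sin_nonneg_of_nonneg_of_le_pi <;> nlinarith
  · have : 0 < Real.sin (2 * Real.pi * t - Real.pi) := by
      apply Real.sin_pos_of_pos_of_lt_pi <;> nlinarith
    rw [Real.sin_sub_pi] at this
    linarith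
  · have : Real.cos (2 * Real.pi * t) ≤ 0 := by
      apply Real.cos_nonpos_of_pi_div_two_le_of_le <;> nlinarith
    linarith
  · rw [h]; simp

lemma Phi_circle_right {γ : ℝ → ℝ × ℝ} (hγ : Continuous γ) (hf : ∀ t, γ t ∈ fig8)
    (h : ∀ t ∈ Icc (0:ℝ) 1, γ t = (1 - Real.cos (2 * Real.pi * t), Real.sin (2 * Real.pi * t))) :
    Phi γ = bI := by
  apply Phi_eq hγ hf
  filter_upwards [eventually_ge_atTop 2] with n hn
  have h4 : (4:ℝ) ≤ 2 ^ n := by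
    calc (4:ℝ) = 2 ^ 2 := by norm_num
      _ ≤ 2 ^ n := pow_le_pow_right₀ (by norm_num) hn
  unfold Dn
  classical
  rw [Pw_cobdry (fun i => if (i:ℝ) / 2 ^ n ≤ 1/2 then 1 else bI)]
  · norm_num
  · intro i hi
    have g0 := grid_mem (n := n) (i := i) (by omega)
    have g1 := grid_mem (n := n) (i := i + 1) (by omega)
    have hst : ((i + 1 : ℕ) : ℝ) / 2 ^ n = (i : ℝ) / 2 ^ n + 1 / 2 ^ n := by push_cast; ring
    have hs0 : (0:ℝ) < 1 / 2 ^ n := by positivity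
    have hs1 : (1:ℝ) / 2 ^ n ≤ 1 / 4 := one_div_le_one_div_of_le (by norm_num) h4
    beta_reduce
    generalize (1:ℝ) / 2 ^ n = δ at *
    generalize ((i + 1 : ℕ) : ℝ) / 2 ^ n = t at *
    generalize (i : ℝ) / 2 ^ n = s at *
    rw [h s g0, h t g1]
    obtain ⟨a1, a2, a3, a4⟩ := circle_facts g0
    obtain ⟨b1, b2, b3, b4⟩ := circle_facts g1
    have hcs : 0 ≤ 1 - Real.cos (2 * Real.pi * s) := by linarith [Real.cos_le_one (2 * Real.pi * s)]
    have n1 : ¬ (1 - Real.cos (2 * Real.pi * s) ≤ -1) := by linarith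
    unfold cc
    by_cases c1 : t ≤ 1/2
    · have c2 : s ≤ 1/2 := by linarith
      have := a1 c2
      have := b1 c1
      rw [if_neg, if_neg, if_pos c1, if_pos c2]
      · simp
      · rintro ⟨h, _⟩; exact n1 h
      · rintro ⟨_, _, h⟩; apply h; constructor <;> intro <;> linarith
    · push Not at c1
      by_cases c2 : s ≤ 1/2
      · have x1 := a1 c2
        have x2 := b2 c1 (by linarith)
        rw [if_pos, if_pos c2, if_neg (by linarith)]
        · simp
        · refine ⟨a3 (by linarith) (by linarith), b3 (by linarith) (by linarith), ?_⟩
          intro h; have := h.2 x2; simp only [] at this; linarith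
      · push Not at c2
        have x1 := a2 c2 (by linarith [g1.2])
        rw [if_neg, if_neg, if_neg (by linarith), if_neg (by linarith)]
        · simp
        · rintro ⟨h, _⟩; exact n1 h
        · rintro ⟨_, h, h'⟩
          rcases lt_or_eq_of_le g1.2 with h1 | h1
          · have := b2 c1 h1
            apply h'; constructor <;> intro <;> linarith
          · have := b4 h1
            simp only [] at h
            linarith

lemma Phi_circle_left {γ : ℝ → ℝ × ℝ} (hγ : Continuous γ) (hf : ∀ t, γ t ∈ fig8)
    (h : ∀ t ∈ Icc (0:ℝ) 1, γ t = (-(1 - Real.cos (2 * Real.pi * t)), Real.sin (2 * Real.pi * t))) :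
    Phi γ = aI := by
  apply Phi_eq hγ hf
  filter_upwards [eventually_ge_atTop 2] with n hn
  have h4 : (4:ℝ) ≤ 2 ^ n := by
    calc (4:ℝ) = 2 ^ 2 := by norm_num
      _ ≤ 2 ^ n := pow_le_pow_right₀ (by norm_num) hn
  unfold Dn
  classical
  rw [Pw_cobdry (fun i => if (i:ℝ) / 2 ^ n ≤ 1/2 then 1 else aI)]
  · norm_num
  · intro i hi
    have g0 := grid_mem (n := n) (i := i) (by omega)
    have g1 := grid_mem (n := n) (i := i + 1) (by omega)
    have hst : ((i + 1 : ℕ) : ℝ) / 2 ^ n = (i : ℝ) / 2 ^ n + 1 / 2 ^ n := by push_cast; ring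
    have hs0 : (0:ℝ) < 1 / 2 ^ n := by positivity
    have hs1 : (1:ℝ) / 2 ^ n ≤ 1 / 4 := one_div_le_one_div_of_le (by norm_num) h4
    beta_reduce
    generalize (1:ℝ) / 2 ^ n = δ at *
    generalize ((i + 1 : ℕ) : ℝ) / 2 ^ n = t at *
    generalize (i : ℝ) / 2 ^ n = s at *
    rw [h s g0, h t g1]
    obtain ⟨a1, a2, a3, a4⟩ := circle_facts g0
    obtain ⟨b1, b2, b3, b4⟩ := circle_facts g1
    have hcs : 0 ≤ 1 - Real.cos (2 * Real.pi * s) := by linarith [Real.cos_le_one (2 * Real.pi * s)]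
    have n1 : ¬ (1 ≤ -(1 - Real.cos (2 * Real.pi * s))) := by linarith
    unfold cc
    rw [if_neg (by rintro ⟨h, _⟩; exact n1 h)]
    by_cases c1 : t ≤ 1/2
    · have c2 : s ≤ 1/2 := by linarith
      have := a1 c2
      have := b1 c1
      rw [if_neg, if_pos c1, if_pos c2]
      · simp
      · rintro ⟨_, _, h⟩; apply h; constructor <;> intro <;> linarith
    · push Not at c1
      by_cases c2 : s ≤ 1/2
      · have x1 := a1 c2
        have x2 := b2 c1 (by linarith)
        rw [if_pos, if_pos c2, if_neg (by linarith)]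
        · simp
        · refine ⟨neg_le_neg (a3 (by linarith) (by linarith)),
            neg_le_neg (b3 (by linarith) (by linarith)), ?_⟩
          intro h; have := h.2 x2; simp only [] at this; linarith
      · push Not at c2
        have x1 := a2 c2 (by linarith [g1.2])
        rw [if_neg, if_neg (by linarith), if_neg (by linarith)]
        · simp
        · rintro ⟨_, h, h'⟩
          rcases lt_or_eq_of_le g1.2 with h1 | h1
          · have := b2 c1 h1
            apply h'; constructor <;> intro <;> linarith
          · have := b4 h1
            simp only [] at h
            linarith

/-! ### Mapping the Hawaiian earring to the figure eight -/

def mm (j : ℕ) (q : ℝ × ℝ) : ℝ :=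
  max 0 (1 - |2 * q.1 - j * (q.1 ^ 2 + q.2 ^ 2)| / (q.1 ^ 2 + q.2 ^ 2))

lemma mm_nonneg (j : ℕ) (q : ℝ × ℝ) : 0 ≤ mm j q := le_max_left _ _

lemma mm_le_one (j : ℕ) (q : ℝ × ℝ) : mm j q ≤ 1 := by
  unfold mm
  apply max_le zero_le_one
  have : 0 ≤ |2 * q.1 - j * (q.1 ^ 2 + q.2 ^ 2)| / (q.1 ^ 2 + q.2 ^ 2) := by positivity
  linarith

lemma mm_smul_continuous (j : ℕ) (g : ℝ × ℝ → ℝ) (hg : Continuous g) (hg0 : g (0, 0) = 0) :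
    Continuous (fun q => g q * mm j q) := by
  rw [continuous_iff_continuousAt]
  intro q
  by_cases hq : q = (0, 0)
  · subst hq
    have h1 : Tendsto (fun q => |g q|) (𝓝 ((0:ℝ),(0:ℝ))) (𝓝 0) := by
      have := (hg.abs).tendsto ((0:ℝ),(0:ℝ))
      simpa [hg0] using this
    unfold ContinuousAt
    beta_reduce
    rw [hg0, zero_mul]
    apply squeeze_zero_norm _ h1
    intro q
    rw [norm_mul, Real.norm_eq_abs, Real.norm_eq_abs, abs_of_nonneg (mm_nonneg j q)]
    exact mul_le_of_le_one_right (abs_nonneg _) (mm_le_one j q)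
  · have hr : q.1 ^ 2 + q.2 ^ 2 ≠ 0 := by
      intro h
      apply hq
      have h1 : q.1 = 0 := by nlinarith [sq_nonneg q.1, sq_nonneg q.2]
      have h2 : q.2 = 0 := by nlinarith [sq_nonneg q.1, sq_nonneg q.2]
      exact Prod.ext h1 h2
    refine hg.continuousAt.mul ?_
    unfold mm
    have hd : ContinuousAt (fun q : ℝ × ℝ => 1 - |2 * q.1 - j * (q.1 ^ 2 + q.2 ^ 2)| /
        (q.1 ^ 2 + q.2 ^ 2)) q :=
      continuousAt_const.sub (ContinuousAt.div (by fun_prop) (by fun_prop) hr)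
    exact continuousAt_const.sup hd

def uk (k : ℕ) (q : ℝ × ℝ) : ℝ × ℝ :=
  (q.1 * mm 1 q + (-(k * q.1)) * mm k q, q.2 * mm 1 q + (k * q.2) * mm k q)

lemma uk_continuous (k : ℕ) : Continuous (uk k) := by
  unfold uk
  refine Continuous.prodMk (Continuous.add ?_ ?_) (Continuous.add ?_ ?_)
  · exact mm_smul_continuous 1 (fun q => q.1) (by fun_prop) (by simp)
  · exact mm_smul_continuous k (fun q => -(k * q.1)) (by fun_prop) (by simp)
  · exact mm_smul_continuous 1 (fun q => q.2) (by fun_prop) (by simp)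
  · exact mm_smul_continuous k (fun q => k * q.2) (by fun_prop) (by simp)

lemma uk_zero (k : ℕ) : uk k (0, 0) = (0, 0) := by simp [uk]

lemma circ_eq {n : ℕ} (hn : 1 ≤ n) {q : ℝ × ℝ} :
    q ∈ circ n ↔ n * (q.1 ^ 2 + q.2 ^ 2) = 2 * q.1 := by
  have hn' : (n:ℝ) ≠ 0 := by positivity
  simp only [circ, mem_ofPred_eq]
  constructor
  · intro h
    field_simp at h
    apply mul_left_cancel₀ hn'
    nlinarith
  · intro h
    field_simp
    nlinarith

lemma mm_circ {n : ℕ} (hn : 1 ≤ n) {q : ℝ × ℝ} (hq : q ∈ circ n) (h0 : q ≠ (0,0)) (j : ℕ) :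
    mm j q = if j = n then 1 else 0 := by
  have hr : q.1 ^ 2 + q.2 ^ 2 ≠ 0 := by
    intro h
    apply h0
    have h1 : q.1 = 0 := by nlinarith [sq_nonneg q.1, sq_nonneg q.2]
    have h2 : q.2 = 0 := by nlinarith [sq_nonneg q.1, sq_nonneg q.2]
    exact Prod.ext h1 h2
  have hr' : 0 < q.1 ^ 2 + q.2 ^ 2 := lt_of_le_of_ne (by positivity) hr.symm
  rw [circ_eq hn] at hq
  have e : |2 * q.1 - j * (q.1 ^ 2 + q.2 ^ 2)| / (q.1 ^ 2 + q.2 ^ 2) = |(n:ℝ) - j| := by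
    rw [← hq, ← sub_mul, abs_mul, abs_of_pos hr', mul_div_assoc, div_self hr, mul_one]
  unfold mm
  rw [e]
  split_ifs with h
  · subst h; simp
  · apply max_eq_left
    have : (1:ℝ) ≤ |(n:ℝ) - j| := by
      have h2 : (1:ℤ) ≤ |(n:ℤ) - j| := Int.one_le_abs (by omega)
      exact_mod_cast h2
    linarith

lemma uk_circ_one {k : ℕ} (hk : 2 ≤ k) {q : ℝ × ℝ} (hq : q ∈ circ 1) : uk k q = q := by
  by_cases h0 : q = (0, 0)
  · subst h0; exact uk_zero k
  · unfold uk
    rw [mm_circ le_rfl hq h0, mm_circ le_rfl hq h0, if_pos rfl, if_neg (by omega)]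
    ext <;> simp

lemma uk_circ_k {k : ℕ} (hk : 2 ≤ k) {q : ℝ × ℝ} (hq : q ∈ circ k) :
    uk k q = (-(k * q.1), k * q.2) := by
  by_cases h0 : q = (0, 0)
  · subst h0; simp [uk_zero]
  · unfold uk
    rw [mm_circ (by omega) hq h0, mm_circ (by omega) hq h0, if_pos rfl, if_neg (by omega)]
    ext <;> simp

lemma uk_circ_other {k n : ℕ} (hn : 1 ≤ n) (h1 : n ≠ 1) (hnk : n ≠ k) {q : ℝ × ℝ}
    (hq : q ∈ circ n) : uk k q = (0, 0) := by
  by_cases h0 : q = (0, 0)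
  · subst h0; simp [uk_zero]
  · unfold uk
    rw [mm_circ hn hq h0, mm_circ hn hq h0, if_neg h1.symm, if_neg hnk.symm]
    ext <;> simp

lemma mem_HE {q : ℝ × ℝ} : q ∈ HE ↔ ∃ n, 1 ≤ n ∧ q ∈ circ n := by
  simp [HE]

lemma circ_fst_nonneg {n : ℕ} (hn : 1 ≤ n) {q : ℝ × ℝ} (hq : q ∈ circ n) : 0 ≤ q.1 := by
  rw [circ_eq hn] at hq
  have : 0 ≤ n * (q.1 ^ 2 + q.2 ^ 2) := by positivity
  linarith

lemma uk_fig8 {k : ℕ} (hk : 2 ≤ k) {q : ℝ × ℝ} (hq : q ∈ HE) : uk k q ∈ fig8 := by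
  obtain ⟨n, hn, hq⟩ := mem_HE.1 hq
  have hx := circ_fst_nonneg hn hq
  by_cases h1 : n = 1
  · subst h1
    rw [uk_circ_one hk hq]
    rw [circ_eq hn] at hq
    simp only [fig8, mem_ofPred_eq, abs_of_nonneg hx]
    simpa using hq
  by_cases h2 : n = k
  · subst h2
    rw [uk_circ_k hk hq]
    rw [circ_eq hn] at hq
    simp only [fig8, mem_ofPred_eq]
    rw [abs_neg, abs_of_nonneg (by positivity)]
    linear_combination (n:ℝ) * hq
  · rw [uk_circ_other hn h1 h2 hq]
    simp [fig8]

lemma uk_far {k : ℕ} (hk : 2 ≤ k) {q : ℝ × ℝ} (hq : q ∈ HE) (h : 1 < q.1) : 1 ≤ (uk k q).1 := by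
  obtain ⟨n, hn, hq⟩ := mem_HE.1 hq
  by_cases h1 : n = 1
  · subst h1
    rw [uk_circ_one hk hq]; exact h.le
  · exfalso
    rw [circ_eq hn] at hq
    have : (2:ℝ) ≤ n := by exact_mod_cast (show 2 ≤ n by omega)
    nlinarith [sq_nonneg q.2]

lemma uk_near {k : ℕ} (hk : 2 ≤ k) {q : ℝ × ℝ} (hq : q ∈ HE) (h : q.1 < 3/2) :
    (uk k q).1 < 3/2 := by
  obtain ⟨n, hn, hq⟩ := mem_HE.1 hq
  have hx := circ_fst_nonneg hn hq
  by_cases h1 : n = 1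
  · subst h1
    rw [uk_circ_one hk hq]; exact h
  by_cases h2 : n = k
  · subst h2
    rw [uk_circ_k hk hq]
    have : 0 ≤ n * q.1 := by positivity
    simp only []
    linarith
  · rw [uk_circ_other hn h1 h2 hq]
    norm_num

lemma bound_exists (g : ℝ → ℝ × ℝ) (hg : Continuous g) (hH : ∀ t, g t ∈ HE) :
    ∃ N : ℕ, ∀ k, 2 ≤ k → len (Phi (fun t => uk k (g t))) ≤ N := by
  obtain ⟨m, hm⟩ := (msh_eventually hg (show (0:ℝ) < 1/4 by norm_num)).exists
  refine ⟨2 ^ m, fun k hk => Phi_bound ((uk_continuous k).comp hg) (fun t => uk_fig8 hk (hH t)) m ?_⟩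
  intro i hi
  have hsub : ∀ t ∈ Icc ((i:ℝ) / 2 ^ m) ((i + 1 : ℝ) / 2 ^ m),
      |(g t).1 - (g ((i:ℝ) / 2 ^ m)).1| < 1/4 := by
    intro t ht
    have g0 := grid_mem (n := m) (i := i) (by omega)
    have g1 := grid_mem (n := m) (i := i + 1) (by omega)
    push_cast at g1
    refine (clo_of_dist (hm t ⟨g0.1.trans ht.1, ht.2.trans g1.2⟩ _ g0 ?_)).1
    rw [abs_of_nonneg (by linarith [ht.1])]
    have := ht.2
    rw [add_div] at this
    linarith
  by_cases hc : (5/4 : ℝ) ≤ (g ((i:ℝ) / 2 ^ m)).1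
  · left
    intro t ht
    apply uk_far hk (hH t)
    linarith [(abs_lt.1 (hsub t ht)).1]
  · right
    intro t ht
    apply uk_near hk (hH t)
    push Not at hc
    linarith [(abs_lt.1 (hsub t ht)).2]

/-- The standard loop around the `n`th circle. -/
def stdFun (n : ℕ) (t : ℝ) : ℝ × ℝ :=
  ((1 - Real.cos (2 * Real.pi * t)) / n, Real.sin (2 * Real.pi * t) / n)

lemma stdFun_mem {n : ℕ} (hn : 1 ≤ n) (t : ℝ) : stdFun n t ∈ circ n := by
  rw [circ_eq hn]
  have hn' : (n:ℝ) ≠ 0 := by positivity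
  simp only [stdFun]
  field_simp
  nlinarith [Real.sin_sq_add_cos_sq (2 * Real.pi * t)]

def stdPath (n : ℕ) (hn : 1 ≤ n) : Path hep hep where
  toFun t := ⟨stdFun n t, mem_HE.2 ⟨n, hn, stdFun_mem hn t⟩⟩
  continuous_toFun := by
    refine Continuous.subtype_mk ?_ _
    unfold stdFun
    fun_prop
  source' := by
    apply Subtype.ext; simp [stdFun, hep]
  target' := by
    apply Subtype.ext; simp [stdFun, hep]

lemma stdPath_tendsto :
    Tendsto (fun k : ℕ => stdPath (k + 1) (by omega)) atTop (𝓝 (Path.refl hep)) := by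
  rw [nhds_induced, tendsto_comap_iff, ContinuousMap.tendsto_iff_tendstoUniformly,
    Metric.tendstoUniformly_iff]
  intro ε hε
  have ht : Tendsto (fun n : ℕ => 2 * (1 / ((n:ℝ) + 1))) atTop (𝓝 0) := by
    simpa using (tendsto_one_div_add_atTop_nhds_zero_nat (𝕜 := ℝ)).const_mul 2
  filter_upwards [ht.eventually (gt_mem_nhds hε)] with n hn t
  refine lt_of_le_of_lt ?_ hn
  show dist ((0:ℝ), (0:ℝ)) (stdFun (n + 1) t) ≤ _
  have hp : (0:ℝ) < (n:ℝ) + 1 := by positivity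
  rw [Prod.dist_eq, Real.dist_eq, Real.dist_eq]
  simp only [stdFun, zero_sub, abs_neg, abs_div]
  push_cast
  rw [abs_of_pos hp, mul_one_div]
  apply max_le
  · refine div_le_div_of_nonneg_right ?_ hp.le
    rw [abs_le]
    constructor <;> linarith [Real.cos_le_one (2 * Real.pi * t), Real.neg_one_le_cos (2 * Real.pi * t)]
  · refine div_le_div_of_nonneg_right ?_ hp.le
    linarith [Real.abs_sin_le_one (2 * Real.pi * t)]

/-! ### The invariants on the loop space of a space retracting to the Hawaiian earring -/

section Loops

variable {Y : Type*} [TopologicalSpace Y] {q : Y}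

def toLoop (γ : Path q q) : LoopSp Y q := ⟨γ.toContinuousMap, γ.source, γ.target⟩

lemma toLoop_continuous : Continuous (toLoop : Path q q → LoopSp Y q) :=
  Continuous.subtype_mk continuous_induced_dom _

lemma toLoop_surj (f : LoopSp Y q) : ∃ γ : Path q q, toLoop γ = f :=
  ⟨⟨f.1, f.2.1, f.2.2⟩, rfl⟩

lemma joined_of_homotopic {γ γ' : Path q q} (h : γ.Homotopic γ') :
    Joined (toLoop γ) (toLoop γ') := by
  obtain ⟨F⟩ := h
  refine ⟨⟨⟨fun s => toLoop (F.eval s), ?_⟩, ?_, ?_⟩⟩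
  · exact Continuous.subtype_mk (F.toContinuousMap.curry.continuous) _
  · show toLoop (F.eval 0) = _
    rw [F.eval_zero]
  · show toLoop (F.eval 1) = _
    rw [F.eval_one]

def Psi (ρ : C(Y, HE)) (k : ℕ) (f : LoopSp Y q) : Gam :=
  Phi (fun t => uk k (ρ (IccExtend zero_le_one f.1 t)))

lemma psi_cont (ρ : C(Y, HE)) (k : ℕ) (f : C(unitInterval, Y)) :
    Continuous (fun t : ℝ => uk k (ρ (IccExtend zero_le_one f t))) :=
  (uk_continuous k).comp (continuous_subtype_val.comp (ρ.continuous.comp f.continuous.Icc_extend'))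

lemma psi_fig8 (ρ : C(Y, HE)) {k : ℕ} (hk : 2 ≤ k) (f : C(unitInterval, Y)) (t : ℝ) :
    uk k (ρ (IccExtend zero_le_one f t)) ∈ fig8 := uk_fig8 hk (ρ _).2

lemma Psi_locConst (ρ : C(Y, HE)) {k : ℕ} (hk : 2 ≤ k) :
    IsLocallyConstant (Psi (q := q) ρ k) := by
  rw [IsLocallyConstant.iff_eventually_eq]
  intro f
  let u : C(Y, ℝ × ℝ) := ⟨fun y => uk k (ρ y), (uk_continuous k).comp
    (continuous_subtype_val.comp ρ.continuous)⟩
  have hc : Continuous (fun g : LoopSp Y q => u.comp g.1) :=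
    (ContinuousMap.continuous_postcomp u).comp continuous_subtype_val
  have hev := hc.continuousAt (x := f) (Metric.ball_mem_nhds _ (show (0:ℝ) < 1/12 by norm_num))
  filter_upwards [hev] with g hg
  refine Phi_close (psi_cont ρ k _) (psi_fig8 ρ hk _) (psi_cont ρ k _) (psi_fig8 ρ hk _) ?_ ?_ ?_
  · intro t _
    exact lt_of_le_of_lt (ContinuousMap.dist_apply_le_dist (f := u.comp g.1) (g := u.comp f.1)
      (projIcc 0 1 zero_le_one t)) hg
  · have e : IccExtend zero_le_one g.1 0 = IccExtend zero_le_one f.1 0 := by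
      rw [IccExtend_left, IccExtend_left]; exact g.2.1.trans f.2.1.symm
    rw [e]
  · have e : IccExtend zero_le_one g.1 1 = IccExtend zero_le_one f.1 1 := by
      rw [IccExtend_right, IccExtend_right]; exact g.2.2.trans f.2.2.symm
    rw [e]

lemma Psi_joined (ρ : C(Y, HE)) {k : ℕ} (hk : 2 ≤ k) {f g : LoopSp Y q} (h : Joined f g) :
    Psi ρ k f = Psi ρ k g := by
  obtain ⟨γ⟩ := h
  have := ((Psi_locConst (q := q) ρ hk).comp_continuous γ.continuous).apply_eq_of_preconnectedSpace 0 1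
  simpa using this

lemma Psi_trans (ρ : C(Y, HE)) {k : ℕ} (hk : 2 ≤ k) (γ γ' : Path q q) :
    Psi ρ k (toLoop (γ.trans γ')) = Psi ρ k (toLoop γ) * Psi ρ k (toLoop γ') := by
  refine Phi_trans (psi_cont ρ k _) (psi_fig8 ρ hk _) (psi_cont ρ k _) (psi_fig8 ρ hk _)
    (psi_cont ρ k _) (psi_fig8 ρ hk _) ?_ ?_
  · intro t ht
    exact congrArg (fun y => uk k (ρ y)) (Path.extend_trans_of_le_half γ γ' ht)
  · intro t ht
    exact congrArg (fun y => uk k (ρ y)) (Path.extend_trans_of_half_le γ γ' ht)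

lemma Psi_refl (ρ : C(Y, HE)) {k : ℕ} (hk : 2 ≤ k) :
    Psi ρ k (toLoop (Path.refl q)) = 1 := by
  have := Psi_trans ρ hk (Path.refl q) (Path.refl q)
  rw [Path.refl_trans_refl] at this
  exact mul_eq_left.1 this.symm

lemma Psi_symm (ρ : C(Y, HE)) {k : ℕ} (hk : 2 ≤ k) (γ : Path q q) :
    Psi ρ k (toLoop γ.symm) = (Psi ρ k (toLoop γ))⁻¹ := by
  have h1 := Psi_joined ρ hk (joined_of_homotopic ⟨Path.Homotopy.reflTransSymm γ⟩)
  rw [Psi_refl ρ hk, Psi_trans ρ hk] at h1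
  exact eq_inv_of_mul_eq_one_right h1.symm

lemma Psi_bound (ρ : C(Y, HE)) (f : LoopSp Y q) :
    ∃ N : ℕ, ∀ k, 2 ≤ k → len (Psi ρ k f) ≤ N :=
  bound_exists (fun t => ρ (IccExtend zero_le_one f.1 t))
    (continuous_subtype_val.comp (ρ.continuous.comp f.1.continuous.Icc_extend'))
    (fun _ => Subtype.coe_prop _)

def pcomm (α β : Path q q) : Path q q := (α.trans β).trans (α.symm.trans β.symm)

def itr (γ α β : Path q q) : ℕ → Path q q
  | 0 => γ
  | n + 1 => (itr γ α β n).trans (pcomm α β)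

lemma pcomm_continuous (α : Path q q) : Continuous (pcomm α) := by
  unfold pcomm
  exact Path.continuous_trans.comp (Continuous.prodMk
    (Path.continuous_trans.comp (continuous_const.prodMk continuous_id))
    (Path.continuous_trans.comp (continuous_const.prodMk Path.continuous_symm)))

lemma itr_continuous (γ α : Path q q) (n : ℕ) : Continuous (fun β => itr γ α β n) := by
  induction n with
  | zero => exact continuous_const
  | succ n ih => exact Path.continuous_trans.comp (ih.prodMk (pcomm_continuous α))

lemma pcomm_refl (α : Path q q) : (pcomm α (Path.refl q)).Homotopic (Path.refl q) := by
  unfold pcomm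
  rw [Path.refl_symm]
  have h1 : (α.trans (Path.refl q)).Homotopic α := ⟨Path.Homotopy.transRefl α⟩
  have h2 : (α.symm.trans (Path.refl q)).Homotopic α.symm := ⟨Path.Homotopy.transRefl α.symm⟩
  have h3 : (Path.refl q).Homotopic (α.trans α.symm) := ⟨Path.Homotopy.reflTransSymm α⟩
  exact (h1.hcomp h2).trans h3.symm

lemma itr_refl (γ α : Path q q) (n : ℕ) : (itr γ α (Path.refl q) n).Homotopic γ := by
  induction n with
  | zero => exact Path.Homotopic.refl _
  | succ n ih =>
    have h1 : (γ.trans (Path.refl q)).Homotopic γ := ⟨Path.Homotopy.transRefl γ⟩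
    exact (ih.hcomp (pcomm_refl α)).trans h1

lemma Psi_itr (ρ : C(Y, HE)) {k : ℕ} (hk : 2 ≤ k) (γ α β : Path q q)
    (hα : Psi ρ k (toLoop α) = bI) (hβ : Psi ρ k (toLoop β) = aI) (n : ℕ) (x : ℤ) :
    Psi ρ k (toLoop (itr γ α β n)) x = Psi ρ k (toLoop γ) (x + 2 * n) := by
  induction n generalizing x with
  | zero => simp [itr]
  | succ n ih =>
    have hb : bI⁻¹ = bI := inv_eq_of_mul_eq_one_left bI_mul
    have ha : aI⁻¹ = aI := inv_eq_of_mul_eq_one_left aI_mul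
    rw [itr, pcomm, Psi_trans ρ hk, Psi_trans ρ hk, Psi_trans ρ hk, Psi_trans ρ hk, Psi_symm ρ hk,
      Psi_symm ρ hk, hα, hβ, ha, hb]
    show Psi ρ k (toLoop (itr γ α β n)) (bI (aI (bI (aI x)))) = _
    rw [ih]
    simp only [aI_apply, bI_apply]
    congr 1
    push_cast
    ring

lemma main_aux (ρ : C(Y, HE)) (h : C(HE, Y)) (hρ : ∀ x, ρ (h x) = x) [BaireSpace (TopPi1 Y (h hep))] :
    False := by
  let mk : LoopSp Y (h hep) → TopPi1 Y (h hep) := Quotient.mk _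
  have hmk : IsQuotientMap mk := isQuotientMap_quotient_mk'
  let F : ℕ → Set (TopPi1 Y (h hep)) := fun N =>
    {x | ∀ f, mk f = x → ∀ k, 2 ≤ k → len (Psi ρ k f) ≤ N}
  have hmem : ∀ N f, mk f ∈ F N ↔ ∀ k, 2 ≤ k → len (Psi ρ k f) ≤ N := by
    intro N f
    constructor
    · intro hf; exact hf f rfl
    · intro hf g hg k hk
      rw [Psi_joined ρ hk (Quotient.exact hg : Joined g f)]
      exact hf k hk
  have hcl : ∀ N, IsClosed (F N) := by
    intro N
    rw [← hmk.isClosed_preimage]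
    have e : mk ⁻¹' F N = ⋂ k, ⋂ (_ : 2 ≤ k), {f | len (Psi ρ k f) ≤ N} := by
      ext f
      rw [mem_preimage, hmem]
      simp
    rw [e]
    refine isClosed_iInter fun k => isClosed_iInter fun hk => ?_
    have ho := Psi_locConst (q := h hep) ρ hk {g | ¬ len g ≤ N}
    exact ⟨ho⟩
  have hun : ⋃ N, F N = univ := by
    rw [eq_univ_iff_forall]
    intro x
    obtain ⟨f, rfl⟩ := hmk.surjective x
    obtain ⟨N, hN⟩ := Psi_bound ρ f
    exact mem_iUnion.2 ⟨N, (hmem N f).2 hN⟩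
  haveI : Nonempty (TopPi1 Y (h hep)) := ⟨mk (toLoop (Path.refl _))⟩
  obtain ⟨N, x, hx⟩ := nonempty_interior_of_iUnion_of_closed hcl hun
  obtain ⟨f, rfl⟩ := hmk.surjective x
  obtain ⟨γ, rfl⟩ := toLoop_surj f
  obtain ⟨N0, hN0⟩ := Psi_bound ρ (toLoop γ)
  let α : Path (h hep) (h hep) := (stdPath 1 le_rfl).map h.continuous
  let β : ℕ → Path (h hep) (h hep) := fun k => (stdPath (k + 1) (by omega)).map h.continuous
  let M := N + N0 + 1
  have hβ : Tendsto β atTop (𝓝 (Path.refl (h hep))) := by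
    have h1 := stdPath_tendsto
    rw [nhds_induced, tendsto_comap_iff] at h1 ⊢
    exact ((ContinuousMap.continuous_postcomp h).tendsto _).comp h1
  have hlim : Tendsto (fun k => mk (toLoop (itr γ α (β k) M))) atTop (𝓝 (mk (toLoop γ))) := by
    have e : mk (toLoop γ) = mk (toLoop (itr γ α (Path.refl _) M)) :=
      (Quotient.sound (joined_of_homotopic (itr_refl γ α M))).symm
    rw [e]
    exact ((hmk.continuous.comp (toLoop_continuous.comp (itr_continuous γ α M))).tendsto _).comp hβ
  obtain ⟨k, hk1, hk2⟩ := ((hlim.eventually (isOpen_interior.mem_nhds hx)).and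
    (eventually_ge_atTop 1)).exists
  have hk : 2 ≤ k + 1 := by omega
  have hle := (hmem N _).1 (interior_subset hk1) (k + 1) hk
  have key : ∀ n (hn : 1 ≤ n), ∀ t (ht : t ∈ Icc (0:ℝ) 1),
      uk (k+1) (ρ (IccExtend zero_le_one (toLoop ((stdPath n hn).map h.continuous)).1 t)) =
      uk (k+1) (stdFun n t) := by
    intro n hn t ht
    rw [IccExtend_of_mem _ _ ht]
    show uk (k+1) (ρ (h (stdPath n hn ⟨t, ht⟩))) = _
    rw [hρ]
    rfl
  have pα : Psi ρ (k+1) (toLoop α) = bI := by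
    refine Phi_circle_right (psi_cont ρ _ _) (psi_fig8 ρ hk _) fun t ht => ?_
    rw [key 1 le_rfl t ht, uk_circ_one hk (stdFun_mem le_rfl t)]
    simp [stdFun]
  have pβ : Psi ρ (k+1) (toLoop (β k)) = aI := by
    refine Phi_circle_left (psi_cont ρ _ _) (psi_fig8 ρ hk _) fun t ht => ?_
    rw [key (k+1) (by omega) t ht, uk_circ_k hk (stdFun_mem (by omega) t)]
    have : ((k + 1 : ℕ) : ℝ) ≠ 0 := by positivity
    simp only [stdFun]
    ext
    · simp only []; field_simp
    · simp only []; field_simp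
  have e := Psi_itr ρ hk γ α (β k) pα pβ M 0
  have hb := hN0 (k+1) hk
  have hd := natAbs_sub_apply (Psi ρ (k+1) (toLoop γ)) (0 + 2 * M) 0
  unfold len at hle hb
  rw [e] at hle
  omega

end Loops
/-- The Hawaiian earring cannot be embedded as a retract of any space
whose topological fundamental group admits a complete metric: if `h : HE → Y` is a
topological embedding and `r : Y → Y` is a continuous retraction of `Y` onto `h(HE)`
(i.e. `r` takes values in `h(HE)` and fixes `h(HE)` pointwise), then `π₁(Y, h p)`, with
the quotient topology, admits no complete metric compatible with its topology. -/
theorem no_retract_of_HE_into_completely_metrizable_pi1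
    (Y : Type*) [TopologicalSpace Y] (h : HE → Y) (hemb : Topology.IsEmbedding h)
    (r : C(Y, Y)) (hr_mem : ∀ y : Y, r y ∈ Set.range h)
    (hr_fix : ∀ y ∈ Set.range h, r y = y) :
    ¬ ∃ m : MetricSpace (TopPi1 Y (h hep)),
        m.toUniformSpace.toTopologicalSpace = instTopologicalSpaceQuotient ∧
        @CompleteSpace (TopPi1 Y (h hep)) m.toUniformSpace := by
  rintro ⟨m, hm, hc⟩
  have hB : @BaireSpace (TopPi1 Y (h hep)) m.toUniformSpace.toTopologicalSpace := by
    letI := m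
    infer_instance
  rw [hm] at hB
  have hrr : ∀ y, ∃ x, h x = r y := fun y => hr_mem y
  choose g hg using hrr
  have hgc : Continuous g := by
    rw [hemb.isInducing.continuous_iff]
    have : h ∘ g = r := funext hg
    rw [this]
    exact r.continuous
  refine main_aux (ρ := ⟨g, hgc⟩) (h := ⟨h, hemb.continuous⟩) ?_
  intro x
  apply hemb.injective
  show h (g (h x)) = h x
  rw [hg, hr_fix _ (mem_range_self x)]

end
end
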